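/- Suppose B ⊊ DK(A). Consider the integral domain Â := k[X_1,…,X_m,Y,Z,T]/(X_1^{r_1}⋯X_m^{r_m}Y − f(Z,T)), made into a ℤ-graded ring by assigning weights wt(x̂_i) = −1 for every i ∈ {1,…,m}, wt(ẑ) = wt(t̂) = 0 and wt(ŷ) = r_1+⋯+r_m, where x̂_1,…,x̂_m,ŷ,ẑ,t̂ denote the images of X_1,…,X_m,Y,Z,T in Â (note the defining relation is homogeneous of degree 0). Then Â admits a non-trivial homogeneous exponential map φ̂ such that ŷ ∈ Â^{φ̂}. -/

import Mathlib

/-!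
Common definitions: exponential maps, the Derksen and Makar-Limanov invariants,
𝔸ⁿ-fibrations, and the ring
`A = k[X_1,…,X_m,Y,Z,T]/(X_1^{r_1}⋯X_m^{r_m}·Y − F(X_1,…,X_m,Z,T))`.
-/

noncomputable section
open MvPolynomial

/-- An exponential map on a `k`-algebra `D`: a `k`-algebra homomorphism `φ : D → D[U]`
such that evaluating `U` at `0` gives the identity of `D`, and such that
`φ_V ∘ φ_U = φ_{U+V}` in `D[U,V]` (where `φ_V : D[U] → D[U,V]` extends `φ` with
`φ_V(U) = U`).  Here `D[U,V]` is modelled as `Polynomial (Polynomial D)`, with inner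
variable `U` and outer variable `V`. -/
structure ExpMap (k D : Type) [CommRing k] [CommRing D] [Algebra k D] where
  toAlgHom : D →ₐ[k] Polynomial D
  eval_zero : ∀ d, Polynomial.eval 0 (toAlgHom d) = d
  comp_add : ∀ d,
    Polynomial.eval₂ ((Polynomial.mapRingHom (Polynomial.C (R := D))).comp toAlgHom.toRingHom)
      (Polynomial.C Polynomial.X) (toAlgHom d)
    = Polynomial.eval₂ ((Polynomial.C (R := Polynomial D)).comp (Polynomial.C (R := D)))
      (Polynomial.C Polynomial.X + Polynomial.X) (toAlgHom d)

namespace ExpMap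
variable {k D : Type} [CommRing k] [CommRing D] [Algebra k D]

/-- The ring of invariants `D^φ = {d ∈ D | φ(d) = d}` of an exponential map. -/
def invariants (φ : ExpMap k D) : Subalgebra k D where
  carrier := {d | φ.toAlgHom d = Polynomial.C d}
  mul_mem' := fun ha hb => by
    simp only [Set.mem_setOf_eq] at *
    rw [map_mul, ha, hb, ← map_mul]
  add_mem' := fun ha hb => by
    simp only [Set.mem_setOf_eq] at *
    rw [map_add, ha, hb, ← map_add]
  algebraMap_mem' := fun c => by
    simp only [Set.mem_setOf_eq, AlgHom.commutes, Polynomial.algebraMap_apply]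

end ExpMap

/-- The Derksen invariant `DK(D)`: the `k`-subalgebra of `D` generated by the rings of
invariants of all non-trivial exponential maps on `D`. -/
def Derksen (k D : Type) [CommRing k] [CommRing D] [Algebra k D] : Subalgebra k D :=
  Algebra.adjoin k (⋃ φ ∈ {ψ : ExpMap k D | ψ.invariants ≠ ⊤}, (φ.invariants : Set D))

/-- The Makar-Limanov invariant `ML(D)`: the intersection of the rings of invariants of
all exponential maps on `D`. -/
def MakarLimanov (k D : Type) [CommRing k] [CommRing D] [Algebra k D] : Subalgebra k D :=
  ⨅ φ : ExpMap k D, φ.invariants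

/-- `D` is an `𝔸ⁿ`-fibration over `R`: a finitely generated flat `R`-algebra all of whose
fibres `D ⊗_R κ(p)` over primes `p` of `R` are polynomial rings `κ(p)^{[n]}`. -/
def IsAnFibration (R D : Type) [CommRing R] [CommRing D] [Algebra R D] (n : ℕ) : Prop :=
  Algebra.FiniteType R D ∧ Module.Flat R D ∧
  ∀ p : PrimeSpectrum R,
    Nonempty ((TensorProduct R (IsLocalRing.ResidueField (Localization.AtPrime p.asIdeal)) D)
      ≃ₐ[IsLocalRing.ResidueField (Localization.AtPrime p.asIdeal)]
      MvPolynomial (Fin n) (IsLocalRing.ResidueField (Localization.AtPrime p.asIdeal)))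

/-- The polynomial ring `k[X_1,…,X_m,Y,Z,T]`:
variables `Sum.inl i` are the `X i`; `Sum.inr 0 = Y`, `Sum.inr 1 = Z`, `Sum.inr 2 = T`. -/
abbrev BigP (k : Type) [CommRing k] (m : ℕ) := MvPolynomial (Fin m ⊕ Fin 3) k

/-- The inclusion `k[X_1,…,X_m,Z,T] → k[X_1,…,X_m,Y,Z,T]` (in the source,
`Sum.inr 0 = Z` and `Sum.inr 1 = T`). -/
def incl (k : Type) [CommRing k] (m : ℕ) : MvPolynomial (Fin m ⊕ Fin 2) k →ₐ[k] BigP k m :=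
  rename (Sum.map id Fin.succ)

/-- The polynomial `G = X_1^{r_1}⋯X_m^{r_m}·Y − F(X_1,…,X_m,Z,T)`. -/
def relG (k : Type) [CommRing k] (m : ℕ) (r : Fin m → ℕ) (F : MvPolynomial (Fin m ⊕ Fin 2) k) :
    BigP k m :=
  (∏ i, X (Sum.inl i) ^ r i) * X (Sum.inr 0) - incl k m F

/-- The ring `A = k[X_1,…,X_m,Y,Z,T]/(X_1^{r_1}⋯X_m^{r_m}·Y − F(X_1,…,X_m,Z,T))`. -/
abbrev RingA (k : Type) [CommRing k] (m : ℕ) (r : Fin m → ℕ)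
    (F : MvPolynomial (Fin m ⊕ Fin 2) k) :=
  BigP k m ⧸ Ideal.span {relG k m r F}

variable (k : Type) [CommRing k] (m : ℕ) (r : Fin m → ℕ) (F : MvPolynomial (Fin m ⊕ Fin 2) k)

/-- `x i`, the image of `X i` in `A`. -/
def xA (i : Fin m) : RingA k m r F := Ideal.Quotient.mk _ (X (Sum.inl i))
/-- `y`, the image of `Y` in `A`. -/
def yA : RingA k m r F := Ideal.Quotient.mk _ (X (Sum.inr 0))
/-- `z`, the image of `Z` in `A`. -/
def zA : RingA k m r F := Ideal.Quotient.mk _ (X (Sum.inr 1))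
/-- `t`, the image of `T` in `A`. -/
def tA : RingA k m r F := Ideal.Quotient.mk _ (X (Sum.inr 2))

/-- `f(Z,T) := F(0,…,0,Z,T) ∈ k[Z,T]`. -/
def fOf : MvPolynomial (Fin 2) k :=
  aeval (Sum.elim (fun _ => (0 : MvPolynomial (Fin 2) k)) X) F

/-- The subalgebra `E = k[x_1,…,x_m]` of `A`. -/
def EA : Subalgebra k (RingA k m r F) := Algebra.adjoin k (Set.range (xA k m r F))

/-- The subalgebra `B = k[x_1,…,x_m,z,t]` of `A`. -/
def BA : Subalgebra k (RingA k m r F) :=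
  Algebra.adjoin k (Set.range (xA k m r F) ∪ {zA k m r F, tA k m r F})

/-!
STATEMENT 10 (Lemma `fdk1`).  Suppose `B ⊊ DK(A)`.  Consider
`Â = k[X_1,…,X_m,Y,Z,T]/(X_1^{r_1}⋯X_m^{r_m}Y − f(Z,T))`, graded by the weights
`wt(x̂_i) = −1`, `wt(ẑ) = wt(t̂) = 0`, `wt(ŷ) = r_1+⋯+r_m`.  Then `Â` admits a
non-trivial homogeneous exponential map `φ̂` with `ŷ ∈ Â^{φ̂}`.
-/

/-- The relation `X_1^{r_1}⋯X_m^{r_m}·Y − f(Z,T)` defining `Â`. -/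
def relHat : BigP k m :=
  (∏ i, X (Sum.inl i) ^ r i) * X (Sum.inr 0)
    - rename (fun j : Fin 2 => Sum.inr j.succ) (fOf k m F)

/-- The ring `Â = k[X_1,…,X_m,Y,Z,T]/(X_1^{r_1}⋯X_m^{r_m}·Y − f(Z,T))`. -/
abbrev AHat := BigP k m ⧸ Ideal.span {relHat k m r F}

/-- `ŷ`, the image of `Y` in `Â`. -/
def yHat : AHat k m r F := Ideal.Quotient.mk _ (X (Sum.inr 0))

/-- The weights: `wt(X_i) = −1` for all `i`, `wt(Y) = r_1+⋯+r_m`, `wt(Z) = wt(T) = 0`. -/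
def wtHat : Fin m ⊕ Fin 3 → ℤ :=
  Sum.elim (fun _ => -1) (fun j => if j = 0 then (∑ i, (r i : ℤ)) else 0)

/-- `a ∈ Â` is homogeneous of degree `d` for the above grading: it is the image of a
weighted-homogeneous polynomial of weighted degree `d`. -/
def IsHomElem (a : AHat k m r F) (d : ℤ) : Prop :=
  ∃ p : BigP k m, p.IsWeightedHomogeneous (wtHat m r) d ∧ Ideal.Quotient.mk _ p = a


section Filtration

variable {K σ : Type} [Field K]

/-- Every monomial of `p` has `W`-weight at most `n`. -/
def DegLE (W : σ → ℚ) (n : ℚ) (p : MvPolynomial σ K) : Prop :=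
  ∀ s, coeff s p ≠ 0 → Finsupp.weight W s ≤ n

lemma DegLE.mono {W : σ → ℚ} {n n' : ℚ} {p : MvPolynomial σ K} (h : DegLE W n p) (hn : n ≤ n') :
    DegLE W n' p := fun s hs => (h s hs).trans hn

lemma DegLE.zero (W : σ → ℚ) (n : ℚ) : DegLE W n (0 : MvPolynomial σ K) :=
  fun s hs => absurd (coeff_zero s) hs

lemma DegLE.add {W : σ → ℚ} {n : ℚ} {p q : MvPolynomial σ K} (hp : DegLE W n p)
    (hq : DegLE W n q) : DegLE W n (p + q) := by
  intro s hs
  by_cases h : coeff s p = 0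
  · exact hq s fun h' => hs (by simp [h, h'])
  · exact hp s h

lemma DegLE.smul {W : σ → ℚ} {n : ℚ} {p : MvPolynomial σ K} (hp : DegLE W n p) (c : K) :
    DegLE W n (c • p) := fun s hs => hp s fun h => hs (by simp [h])

lemma DegLE.neg {W : σ → ℚ} {n : ℚ} {p : MvPolynomial σ K} (hp : DegLE W n p) :
    DegLE W n (-p) := fun s hs => hp s fun h => hs (by simp [h])

lemma DegLE.mul {W : σ → ℚ} {i j : ℚ} {p q : MvPolynomial σ K} (hp : DegLE W i p)
    (hq : DegLE W j q) : DegLE W (i + j) (p * q) := by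
  classical
  intro s hs
  rw [coeff_mul] at hs
  obtain ⟨⟨u, v⟩, huv, h⟩ := Finset.exists_ne_zero_of_sum_ne_zero hs
  rw [Finset.HasAntidiagonal.mem_antidiagonal] at huv
  simp only at huv h
  rw [← huv, map_add]
  exact add_le_add (hp u (left_ne_zero_of_mul h)) (hq v (right_ne_zero_of_mul h))

lemma MvPolynomial.IsWeightedHomogeneous.degLE {W : σ → ℚ} {n : ℚ} {p : MvPolynomial σ K}
    (h : p.IsWeightedHomogeneous W n) : DegLE W n p := fun _ hs => (h hs).le

lemma DegLE.component_eq_zero {W : σ → ℚ} {n n' : ℚ} {p : MvPolynomial σ K} (h : DegLE W n p)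
    (hn : n < n') : weightedHomogeneousComponent W n' p = 0 := by
  classical
  ext s
  rw [coeff_weightedHomogeneousComponent, coeff_zero]
  split_ifs with hs
  · by_contra h0
    exact absurd (h s h0) (by rw [hs]; exact not_le.mpr hn)
  · rfl

lemma DegLE.component_mul {W : σ → ℚ} {i j : ℚ} {p q : MvPolynomial σ K} (hp : DegLE W i p)
    (hq : DegLE W j q) :
    weightedHomogeneousComponent W (i + j) (p * q) =
      weightedHomogeneousComponent W i p * weightedHomogeneousComponent W j q := by
  classical
  ext s
  rw [coeff_weightedHomogeneousComponent, coeff_mul, coeff_mul]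
  simp only [coeff_weightedHomogeneousComponent]
  split_ifs with hs
  · refine Finset.sum_congr rfl fun ⟨u, v⟩ huv => ?_
    rw [Finset.HasAntidiagonal.mem_antidiagonal] at huv
    simp only at huv ⊢
    by_cases hu : coeff u p = 0
    · simp [hu]
    by_cases hv : coeff v q = 0
    · simp [hv]
    have h1 := hp u hu
    have h2 := hq v hv
    rw [← huv, map_add] at hs
    rw [if_pos (by linarith), if_pos (by linarith)]
  · refine (Finset.sum_eq_zero fun ⟨u, v⟩ huv => ?_).symm
    rw [Finset.HasAntidiagonal.mem_antidiagonal] at huv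
    simp only at huv ⊢
    rw [← huv, map_add] at hs
    split_ifs with h1 h2
    · exact absurd (by rw [h1, h2]) hs
    all_goals simp

lemma exists_degLE_component_ne_zero (W : σ → ℚ) {p : MvPolynomial σ K} (hp : p ≠ 0) :
    ∃ n, DegLE W n p ∧ weightedHomogeneousComponent W n p ≠ 0 := by
  classical
  obtain ⟨s, hs, hmax⟩ := p.support.exists_max_image (Finsupp.weight W)
    (support_nonempty.mpr hp)
  refine ⟨Finsupp.weight W s, fun t ht => hmax t (mem_support_iff.mpr ht), fun h => ?_⟩
  have := congrArg (coeff s) h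
  rw [coeff_weightedHomogeneousComponent, if_pos rfl, coeff_zero] at this
  exact mem_support_iff.mp hs this

/-- The top form of an element of the principal ideal `(G)` lies in the ideal generated by the
top form of `G`. -/
lemma component_mem_span {W : σ → ℚ} {D n : ℚ} {G p : MvPolynomial σ K} (hG : DegLE W D G)
    (hG0 : weightedHomogeneousComponent W D G ≠ 0) (hp : DegLE W n p)
    (hpG : p ∈ Ideal.span {G}) :
    weightedHomogeneousComponent W n p ∈ Ideal.span {weightedHomogeneousComponent W D G} := by
  obtain ⟨h, rfl⟩ := Ideal.mem_span_singleton'.mp hpG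
  rw [mul_comm] at hp ⊢
  rcases eq_or_ne h 0 with rfl | h0
  · simp
  obtain ⟨L, hL, hL0⟩ := exists_degLE_component_ne_zero W h0
  have hne : weightedHomogeneousComponent W (D + L) (G * h) ≠ 0 := by
    rw [hG.component_mul hL]
    exact mul_ne_zero hG0 hL0
  have hle : D + L ≤ n := not_lt.mp fun hlt => hne (hp.component_eq_zero hlt)
  have := hG.component_mul (hL.mono (le_sub_iff_add_le'.mpr hle))
  rw [add_sub_cancel] at this
  rw [this]
  exact Ideal.mul_mem_right _ _ (Ideal.mem_span_singleton_self _)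

/-- `b` is the class, in the quotient by `J`, of the degree `n` form of a representative of
degree at most `n` of `a`. -/
def Lead (W : σ → ℚ) (I J : Ideal (MvPolynomial σ K)) (n : ℚ) (a : MvPolynomial σ K ⧸ I)
    (b : MvPolynomial σ K ⧸ J) : Prop :=
  ∃ p, DegLE W n p ∧ Ideal.Quotient.mk I p = a ∧
    Ideal.Quotient.mk J (weightedHomogeneousComponent W n p) = b

namespace Lead

variable {W : σ → ℚ} {I J : Ideal (MvPolynomial σ K)}

lemma zero (n : ℚ) : Lead W I J n 0 0 := ⟨0, DegLE.zero W n, by simp, by simp⟩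

lemma add {n : ℚ} {a a' : MvPolynomial σ K ⧸ I} {b b' : MvPolynomial σ K ⧸ J}
    (h : Lead W I J n a b) (h' : Lead W I J n a' b') : Lead W I J n (a + a') (b + b') := by
  obtain ⟨p, hp, rfl, rfl⟩ := h
  obtain ⟨p', hp', rfl, rfl⟩ := h'
  exact ⟨p + p', hp.add hp', by simp, by simp⟩

lemma mul {n n' : ℚ} {a a' : MvPolynomial σ K ⧸ I} {b b' : MvPolynomial σ K ⧸ J}
    (h : Lead W I J n a b) (h' : Lead W I J n' a' b') :
    Lead W I J (n + n') (a * a') (b * b') := by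
  obtain ⟨p, hp, rfl, rfl⟩ := h
  obtain ⟨p', hp', rfl, rfl⟩ := h'
  exact ⟨p * p', hp.mul hp', by simp, by rw [hp.component_mul hp', map_mul]⟩

lemma smul {n : ℚ} {a : MvPolynomial σ K ⧸ I} {b : MvPolynomial σ K ⧸ J}
    (h : Lead W I J n a b) (c : K) : Lead W I J n (c • a) (c • b) := by
  obtain ⟨p, hp, rfl, rfl⟩ := h
  exact ⟨c • p, hp.smul c, rfl, by rw [map_smul]; rfl⟩

lemma natCast_mul {n : ℚ} {a : MvPolynomial σ K ⧸ I} {b : MvPolynomial σ K ⧸ J}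
    (h : Lead W I J n a b) (N : ℕ) : Lead W I J n (N * a) (N * b) := by
  obtain ⟨p, hp, rfl, rfl⟩ := h
  have hN : ∀ q : MvPolynomial σ K, (N : K) • q = N * q := fun q => by
    rw [smul_eq_C_mul, map_natCast]
  refine ⟨N * p, hN p ▸ hp.smul (N : K), by rw [map_mul, map_natCast], ?_⟩
  rw [← hN, map_smul, hN, map_mul, map_natCast]

lemma sum {ι : Type*} {s : Finset ι} {n : ℚ} {a : ι → MvPolynomial σ K ⧸ I}
    {b : ι → MvPolynomial σ K ⧸ J} (h : ∀ i ∈ s, Lead W I J n (a i) (b i)) :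
    Lead W I J n (∑ i ∈ s, a i) (∑ i ∈ s, b i) := by
  classical
  induction s using Finset.induction_on with
  | empty => simpa using zero n
  | insert i s hi ih =>
    rw [Finset.sum_insert hi, Finset.sum_insert hi]
    exact (h i (Finset.mem_insert_self i s)).add
      (ih fun j hj => h j (Finset.mem_insert_of_mem hj))

lemma of_lt {n n' : ℚ} {a : MvPolynomial σ K ⧸ I} {b : MvPolynomial σ K ⧸ J}
    (h : Lead W I J n a b) (hn : n < n') : Lead W I J n' a 0 := by
  obtain ⟨p, hp, rfl, rfl⟩ := h
  exact ⟨p, hp.mono hn.le, rfl, by rw [hp.component_eq_zero hn, map_zero]⟩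

lemma of_homogeneous {n : ℚ} {p : MvPolynomial σ K} (h : p.IsWeightedHomogeneous W n) :
    Lead W I J n (Ideal.Quotient.mk I p) (Ideal.Quotient.mk J p) :=
  ⟨p, h.degLE, rfl, by rw [weightedHomogeneousComponent_eq_self h]⟩

lemma exists_homogeneous {n : ℚ} {a : MvPolynomial σ K ⧸ I} {b : MvPolynomial σ K ⧸ J}
    (h : Lead W I J n a b) :
    ∃ p : MvPolynomial σ K, p.IsWeightedHomogeneous W n ∧ Ideal.Quotient.mk J p = b := by
  obtain ⟨p, -, -, rfl⟩ := h
  exact ⟨_, weightedHomogeneousComponent_isWeightedHomogeneous n p, rfl⟩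

lemma unique {D : ℚ} {G : MvPolynomial σ K} (hG : DegLE W D G)
    (hG0 : weightedHomogeneousComponent W D G ≠ 0) {n : ℚ}
    {a : MvPolynomial σ K ⧸ Ideal.span {G}}
    {b b' : MvPolynomial σ K ⧸ Ideal.span {weightedHomogeneousComponent W D G}}
    (h : Lead W _ _ n a b) (h' : Lead W _ _ n a b') : b = b' := by
  obtain ⟨p, hp, rfl, rfl⟩ := h
  obtain ⟨q, hq, hqp, rfl⟩ := h'
  rw [Ideal.Quotient.eq] at hqp ⊢
  have := component_mem_span hG hG0 (sub_eq_add_neg q p ▸ hq.add hp.neg) hqp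
  rw [map_sub] at this
  rw [← neg_sub]
  exact neg_mem this

end Lead

end Filtration

section HigherDerivation

open Polynomial

variable {K R : Type} [CommRing K] [CommRing R] [Algebra K R]

/-- The composition law of an exponential map, read off on coefficients. -/
lemma comp_add_iff_coeff (φ : R →ₐ[K] R[X]) (d : R) :
    (Polynomial.eval₂ ((Polynomial.mapRingHom (Polynomial.C (R := R))).comp φ.toRingHom)
      (Polynomial.C Polynomial.X) (φ d)
    = Polynomial.eval₂ ((Polynomial.C (R := R[X])).comp (Polynomial.C (R := R)))
      (Polynomial.C Polynomial.X + Polynomial.X) (φ d)) ↔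
    ∀ i j, (φ ((φ d).coeff j)).coeff i = ((i + j).choose i : R) * (φ d).coeff (i + j) := by
  have hl : ∀ i j, ((Polynomial.eval₂ ((Polynomial.mapRingHom (Polynomial.C (R := R))).comp
      φ.toRingHom) (Polynomial.C Polynomial.X) (φ d)).coeff i).coeff j =
      (φ ((φ d).coeff j)).coeff i := by
    intro i j
    rw [Polynomial.eval₂_eq_sum, Polynomial.sum, Polynomial.finsetSum_coeff,
      Polynomial.finsetSum_coeff, Finset.sum_eq_single j]
    · simp [-map_pow, ← Polynomial.C_pow, Polynomial.coeff_mul_C, Polynomial.coeff_C_mul,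
        Polynomial.coeff_X_pow]
    · intro n _ hn
      simp [-map_pow, ← Polynomial.C_pow, Polynomial.coeff_mul_C, Polynomial.coeff_C_mul,
        Polynomial.coeff_X_pow, hn.symm]
    · intro hj
      simp [Polynomial.notMem_support_iff.mp hj]
  have hr : ∀ i j, ((Polynomial.eval₂ ((Polynomial.C (R := R[X])).comp (Polynomial.C (R := R)))
      (Polynomial.C Polynomial.X + Polynomial.X) (φ d)).coeff i).coeff j =
      ((i + j).choose i : R) * (φ d).coeff (i + j) := by
    intro i j
    have key : ∀ n, ((((Polynomial.C Polynomial.X + Polynomial.X : R[X][X]) ^ n).coeff i).coeff j)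
        = if n = i + j then ((i + j).choose i : R) else 0 := by
      intro n
      rw [add_comm, Polynomial.coeff_X_add_C_pow, ← Polynomial.C_eq_natCast,
        Polynomial.coeff_mul_C, Polynomial.coeff_X_pow]
      by_cases h : n = i + j
      · subst h; simp
      · rw [if_neg h]
        by_cases h2 : j = n - i
        · have : n < i := by omega
          simp [Nat.choose_eq_zero_of_lt this]
        · simp [h2]
    rw [Polynomial.eval₂_eq_sum, Polynomial.sum, Polynomial.finsetSum_coeff,
      Polynomial.finsetSum_coeff, Finset.sum_eq_single (i + j)]
    · rw [RingHom.comp_apply, Polynomial.coeff_C_mul, Polynomial.coeff_C_mul, key, if_pos rfl,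
        mul_comm]
    · intro n _ hn
      rw [RingHom.comp_apply, Polynomial.coeff_C_mul, Polynomial.coeff_C_mul, key, if_neg hn,
        mul_zero]
    · intro hj
      simp [Polynomial.notMem_support_iff.mp hj]
  constructor
  · intro h i j
    rw [← hl, ← hr, h]
  · intro h
    ext i j
    rw [hl, hr, h]

lemma ExpMap.coeff_coeff (φ : ExpMap K R) (d : R) (i j : ℕ) :
    (φ.toAlgHom ((φ.toAlgHom d).coeff j)).coeff i =
      ((i + j).choose i : R) * (φ.toAlgHom d).coeff (i + j) :=
  (comp_add_iff_coeff φ.toAlgHom d).mp (φ.comp_add d) i j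

lemma ExpMap.coeff_zero (φ : ExpMap K R) (d : R) : (φ.toAlgHom d).coeff 0 = d := by
  rw [Polynomial.coeff_zero_eq_eval_zero, φ.eval_zero]

lemma ExpMap.mem_invariants_iff (φ : ExpMap K R) (d : R) :
    d ∈ φ.invariants ↔ φ.toAlgHom d = Polynomial.C d := Iff.rfl

lemma ExpMap.mem_invariants_iff_coeff (φ : ExpMap K R) (d : R) :
    d ∈ φ.invariants ↔ ∀ j, 1 ≤ j → (φ.toAlgHom d).coeff j = 0 := by
  rw [φ.mem_invariants_iff]
  constructor
  · intro h j hj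
    rw [h, Polynomial.coeff_C, if_neg (by omega)]
  · intro h
    ext j
    rcases Nat.eq_zero_or_pos j with rfl | hj
    · rw [φ.coeff_zero, Polynomial.coeff_C_zero]
    · rw [h j hj, Polynomial.coeff_C, if_neg (by omega)]

/-- The ring of invariants of an exponential map on a domain is factorially closed. -/
lemma ExpMap.mem_invariants_of_mul [IsDomain R] (φ : ExpMap K R) {a b : R} (hab : a * b ≠ 0)
    (h : a * b ∈ φ.invariants) : a ∈ φ.invariants := by
  rw [φ.mem_invariants_iff, map_mul] at h
  have hne : φ.toAlgHom a * φ.toAlgHom b ≠ 0 := by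
    rw [h]; simpa using hab
  have hdeg := congrArg Polynomial.natDegree h
  rw [Polynomial.natDegree_mul (left_ne_zero_of_mul hne) (right_ne_zero_of_mul hne),
    Polynomial.natDegree_C] at hdeg
  have : (φ.toAlgHom a).natDegree = 0 := by omega
  rw [φ.mem_invariants_iff, Polynomial.eq_C_of_natDegree_eq_zero this, φ.coeff_zero]

end HigherDerivation

section AssociatedGraded

variable {K σ : Type} [Field K]

/-- A subalgebra of a quotient of a polynomial ring containing all the variables is everything. -/
lemma subalgebra_quotient_eq_top {I : Ideal (MvPolynomial σ K)}
    (S : Subalgebra K (MvPolynomial σ K ⧸ I)) (h : ∀ i, Ideal.Quotient.mk I (X i) ∈ S) :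
    S = ⊤ := by
  refine eq_top_iff.mpr fun a _ => ?_
  obtain ⟨p, rfl⟩ := Ideal.Quotient.mk_surjective a
  induction p using MvPolynomial.induction_on with
  | C c => exact S.algebraMap_mem c
  | add p q hp hq =>
    rw [map_add]
    exact add_mem (hp trivial) (hq trivial)
  | mul_X p i hp =>
    rw [map_mul]
    exact mul_mem (hp trivial) (h i)

/-- The weight of the parameter `U`: the largest slope at which the coefficients of a nontrivial
exponential map raise the degrees of the generators. -/
lemma exists_slope [Finite σ] {W : σ → ℚ} {I J : Ideal (MvPolynomial σ K)}
    (hsep : ∀ a : MvPolynomial σ K ⧸ I, a ≠ 0 → ∃ δ b, Lead W I J δ a b ∧ b ≠ 0)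
    (φ : ExpMap K (MvPolynomial σ K ⧸ I)) (hφ : φ.invariants ≠ ⊤) :
    ∃ E : ℚ, (∀ i (j : ℕ), ∃ c, Lead W I J (W i + j * E)
        ((φ.toAlgHom (Ideal.Quotient.mk I (X i))).coeff j) c) ∧
      ∃ i, ∃ j : ℕ, ∃ c, 1 ≤ j ∧ c ≠ 0 ∧ Lead W I J (W i + j * E)
        ((φ.toAlgHom (Ideal.Quotient.mk I (X i))).coeff j) c := by
  classical
  have := Fintype.ofFinite σ
  choose δ β hδ hβ using hsep
  set x : σ → MvPolynomial σ K ⧸ I := fun i => Ideal.Quotient.mk I (X i) with hx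
  let S : Finset ((_ : σ) × ℕ) := Finset.univ.sigma fun i => (φ.toAlgHom (x i)).support.erase 0
  have hS : ∀ u : (_ : σ) × ℕ, u ∈ S ↔ u.2 ≠ 0 ∧ (φ.toAlgHom (x u.1)).coeff u.2 ≠ 0 := by
    intro u
    simp [S]
  have hSne : S.Nonempty := by
    by_contra hne
    rw [Finset.not_nonempty_iff_eq_empty] at hne
    refine hφ (subalgebra_quotient_eq_top _ fun i => ?_)
    rw [φ.mem_invariants_iff_coeff]
    intro j hj
    by_contra h
    have : (⟨i, j⟩ : (_ : σ) × ℕ) ∈ S := (hS _).mpr ⟨by simp only; omega, h⟩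
    simp [hne] at this
  let δ' : σ → ℕ → ℚ := fun i j =>
    if h : (φ.toAlgHom (x i)).coeff j ≠ 0 then δ _ h else 0
  have hδ' : ∀ i j (h : (φ.toAlgHom (x i)).coeff j ≠ 0), δ' i j = δ _ h := fun i j h => dif_pos h
  obtain ⟨⟨i₀, j₀⟩, hu, hmax⟩ := S.exists_max_image (fun u => (δ' u.1 u.2 - W u.1) / u.2) hSne
  have hu' := (hS _).mp hu
  simp only at hu' hmax
  have hj₀ : (j₀ : ℚ) ≠ 0 := by exact_mod_cast hu'.1
  refine ⟨(δ' i₀ j₀ - W i₀) / j₀, fun i j => ?_, i₀, j₀, β _ hu'.2, Nat.pos_of_ne_zero hu'.1,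
    hβ _ hu'.2, ?_⟩
  · by_cases h : (φ.toAlgHom (x i)).coeff j = 0
    · exact ⟨0, by rw [h]; exact Lead.zero _⟩
    rcases Nat.eq_zero_or_pos j with rfl | hj
    · refine ⟨Ideal.Quotient.mk J (X i), ?_⟩
      rw [φ.coeff_zero, Nat.cast_zero, zero_mul, add_zero]
      exact Lead.of_homogeneous (isWeightedHomogeneous_X K W i)
    · have hm := hmax ⟨i, j⟩ ((hS _).mpr ⟨hj.ne', h⟩)
      simp only at hm
      have hj' : (0 : ℚ) < j := by exact_mod_cast hj
      rw [div_le_iff₀ hj', hδ' _ _ h] at hm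
      have hle : δ _ h ≤ W i + j * ((δ' i₀ j₀ - W i₀) / j₀) := by linarith
      rcases hle.lt_or_eq with hlt | heq
      · exact ⟨0, (hδ _ h).of_lt hlt⟩
      · exact ⟨_, heq ▸ hδ _ h⟩
  · have : W i₀ + j₀ * ((δ' i₀ j₀ - W i₀) / j₀) = δ _ hu'.2 := by
      rw [mul_div_cancel₀ _ hj₀, hδ' _ _ hu'.2]
      ring
    rw [this]
    exact hδ _ hu'.2

/-- A homomorphism into a polynomial ring which on the variables gives the leading forms of the
coefficients of `φ` does so everywhere. -/
lemma lead_coeff_aeval {W : σ → ℚ} {I J : Ideal (MvPolynomial σ K)} {E : ℚ}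
    (φ : (MvPolynomial σ K ⧸ I) →ₐ[K] Polynomial (MvPolynomial σ K ⧸ I))
    (Φ : MvPolynomial σ K →ₐ[K] Polynomial (MvPolynomial σ K ⧸ J))
    (h : ∀ i (j : ℕ), Lead W I J (W i + j * E) ((φ (Ideal.Quotient.mk I (X i))).coeff j)
      ((Φ (X i)).coeff j)) {n : ℚ} {p : MvPolynomial σ K} (hp : DegLE W n p) (j : ℕ) :
    Lead W I J (n + j * E) ((φ (Ideal.Quotient.mk I p)).coeff j)
      ((Φ (weightedHomogeneousComponent W n p)).coeff j) := by
  classical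
  have hone : ∀ j : ℕ, Lead W I J (0 + j * E) ((φ (Ideal.Quotient.mk I 1)).coeff j)
      ((Φ 1).coeff j) := by
    intro j
    rw [map_one, map_one, map_one, Polynomial.coeff_one, Polynomial.coeff_one]
    split_ifs with hj
    · subst hj
      rw [Nat.cast_zero, zero_mul, add_zero]
      exact Lead.of_homogeneous (isWeightedHomogeneous_one K W)
    · exact Lead.zero _
  have hmul : ∀ {u v : ℚ} {p q : MvPolynomial σ K},
      (∀ j : ℕ, Lead W I J (u + j * E) ((φ (Ideal.Quotient.mk I p)).coeff j) ((Φ p).coeff j)) →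
      (∀ j : ℕ, Lead W I J (v + j * E) ((φ (Ideal.Quotient.mk I q)).coeff j) ((Φ q).coeff j)) →
      ∀ j : ℕ, Lead W I J (u + v + j * E) ((φ (Ideal.Quotient.mk I (p * q))).coeff j)
        ((Φ (p * q)).coeff j) := by
    intro u v p q h1 h2 j
    rw [map_mul, map_mul, map_mul, Polynomial.coeff_mul, Polynomial.coeff_mul]
    refine Lead.sum fun ⟨a, b⟩ hab => ?_
    rw [Finset.HasAntidiagonal.mem_antidiagonal] at hab
    have hj : (u + v + j * E : ℚ) = (u + a * E) + (v + b * E) := by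
      rw [← hab]
      push_cast
      ring
    rw [hj]
    exact (h1 a).mul (h2 b)
  have hmono : ∀ (s : σ →₀ ℕ) (j : ℕ), Lead W I J (Finsupp.weight W s + j * E)
      ((φ (Ideal.Quotient.mk I (monomial s 1))).coeff j) ((Φ (monomial s 1)).coeff j) := by
    intro s
    induction s using Finsupp.induction_linear with
    | zero =>
      rw [map_zero]
      exact hone
    | add f g hf hg =>
      have : (monomial (f + g) 1 : MvPolynomial σ K) = monomial f 1 * monomial g 1 := by
        rw [monomial_mul, one_mul]
      rw [map_add, this]
      exact hmul hf hg
    | single i n =>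
      rw [Finsupp.weight_single, ← X_pow_eq_monomial]
      induction n with
      | zero =>
        rw [zero_smul, pow_zero]
        exact hone
      | succ n ih =>
        rw [add_smul, one_smul, pow_succ]
        exact hmul ih (h i)
  have hmonoc : ∀ (s : σ →₀ ℕ) (c : K) (j : ℕ), Lead W I J (Finsupp.weight W s + j * E)
      ((φ (Ideal.Quotient.mk I (monomial s c))).coeff j) ((Φ (monomial s c)).coeff j) := by
    intro s c j
    have h1 : (monomial s c : MvPolynomial σ K) = c • monomial s 1 := by
      rw [smul_monomial, smul_eq_mul, mul_one]
    have h2 : Ideal.Quotient.mk I (c • monomial s (1 : K)) =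
      c • Ideal.Quotient.mk I (monomial s 1) := rfl
    rw [h1, h2, map_smul, map_smul, Polynomial.coeff_smul, Polynomial.coeff_smul]
    exact (hmono s j).smul c
  rw [weightedHomogeneousComponent_apply, Finset.sum_filter]
  conv in Ideal.Quotient.mk I p => rw [p.as_sum]
  rw [map_sum, map_sum, map_sum, Polynomial.finsetSum_coeff, Polynomial.finsetSum_coeff]
  refine Lead.sum fun s hs => ?_
  split_ifs with hw
  · rw [← hw]
    exact hmonoc s _ j
  · rw [map_zero, Polynomial.coeff_zero]
    refine (hmonoc s _ j).of_lt ?_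
    have := lt_of_le_of_ne (hp s (mem_support_iff.mp hs)) hw
    linarith

/-- A nontrivial exponential map on a filtered hypersurface induces a nontrivial exponential map
on the hypersurface defined by the top form of its equation. -/
theorem exists_graded_expMap [Finite σ] {W : σ → ℚ} {D : ℚ} {G : MvPolynomial σ K}
    {I J : Ideal (MvPolynomial σ K)} (hI : I = Ideal.span {G})
    (hJ : J = Ideal.span {weightedHomogeneousComponent W D G})
    (hG : DegLE W D G) (hG0 : weightedHomogeneousComponent W D G ≠ 0)
    (hsep : ∀ a : MvPolynomial σ K ⧸ I, a ≠ 0 → ∃ δ b, Lead W I J δ a b ∧ b ≠ 0)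
    (φ : ExpMap K (MvPolynomial σ K ⧸ I)) (hφ : φ.invariants ≠ ⊤) :
    ∃ (E : ℚ) (ψ : ExpMap K (MvPolynomial σ K ⧸ J)),
      ψ.invariants ≠ ⊤ ∧
      (∀ n a b, Lead W I J n a b → a ∈ φ.invariants → b ∈ ψ.invariants) ∧
      ∀ n a b, Lead W I J n a b → ∀ j : ℕ,
        Lead W I J (n + j * E) ((φ.toAlgHom a).coeff j) ((ψ.toAlgHom b).coeff j) := by
  classical
  have huniq : ∀ {n : ℚ} {a b b'}, Lead W I J n a b → Lead W I J n a b' → b = b' := by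
    subst hI hJ
    exact fun h h' => Lead.unique hG hG0 h h'
  obtain ⟨E, hex, i₀, j₀, c₀, hj₀, hc₀, hlead₀⟩ := exists_slope hsep φ hφ
  choose c hc using hex
  let Φ : MvPolynomial σ K →ₐ[K] Polynomial (MvPolynomial σ K ⧸ J) :=
    aeval fun i => ∑ j ∈ (φ.toAlgHom (Ideal.Quotient.mk I (X i))).support,
      Polynomial.monomial j (c i j)
  have hΦ : ∀ i j, (Φ (X i)).coeff j = c i j := by
    intro i j
    simp only [Φ, aeval_X, Polynomial.finsetSum_coeff, Polynomial.coeff_monomial]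
    rw [Finset.sum_ite_eq']
    split_ifs with h
    · rfl
    · refine huniq (Lead.zero _) ?_ (n := W i + j * E)
      rw [← Polynomial.notMem_support_iff.mp h]
      exact hc i j
  have hX : ∀ i (j : ℕ), Lead W I J (W i + j * E)
      ((φ.toAlgHom (Ideal.Quotient.mk I (X i))).coeff j) ((Φ (X i)).coeff j) := by
    intro i j
    rw [hΦ]
    exact hc i j
  have hker : ∀ p ∈ J, Φ p = 0 := by
    intro p hp
    obtain ⟨q, rfl⟩ := Ideal.mem_span_singleton'.mp (hJ ▸ hp)
    suffices Φ (weightedHomogeneousComponent W D G) = 0 by rw [map_mul, this, mul_zero]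
    ext j
    have := lead_coeff_aeval φ.toAlgHom Φ hX hG j
    rw [Ideal.Quotient.eq_zero_iff_mem.mpr (hI ▸ Ideal.mem_span_singleton_self G), map_zero] at this
    exact huniq this (Lead.zero _)
  let Ψ : (MvPolynomial σ K ⧸ J) →ₐ[K] Polynomial (MvPolynomial σ K ⧸ J) :=
    Ideal.Quotient.liftₐ J Φ hker
  have hΨ : ∀ p, Ψ (Ideal.Quotient.mk J p) = Φ p := fun p => Ideal.Quotient.lift_mk _ _ _
  have key : ∀ n a b, Lead W I J n a b → ∀ j : ℕ,
      Lead W I J (n + j * E) ((φ.toAlgHom a).coeff j) ((Ψ b).coeff j) := by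
    rintro n a b ⟨p, hp, rfl, rfl⟩ j
    rw [hΨ]
    exact lead_coeff_aeval φ.toAlgHom Φ hX hp j
  have hmon : ∀ s (u : K), Lead W I J (Finsupp.weight W s) (Ideal.Quotient.mk I (monomial s u))
      (Ideal.Quotient.mk J (monomial s u)) :=
    fun s u => Lead.of_homogeneous (isWeightedHomogeneous_monomial W s u rfl)
  refine ⟨E, ⟨Ψ, fun d => ?_, fun d => (comp_add_iff_coeff Ψ d).mpr fun i j => ?_⟩, ?_,
    fun n a b hab ha => ?_, key⟩
  · rw [← Polynomial.coeff_zero_eq_eval_zero]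
    obtain ⟨p, rfl⟩ := Ideal.Quotient.mk_surjective d
    induction p using MvPolynomial.induction_on' with
    | add p q hp hq => rw [map_add, map_add, Polynomial.coeff_add, hp, hq]
    | monomial s u =>
      have := key _ _ _ (hmon s u) 0
      rw [φ.coeff_zero, Nat.cast_zero, zero_mul, add_zero] at this
      exact huniq this (hmon s u)
  · obtain ⟨p, rfl⟩ := Ideal.Quotient.mk_surjective d
    induction p using MvPolynomial.induction_on' with
    | add p q hp hq =>
      simp only [map_add, Polynomial.coeff_add, mul_add, hp, hq]
    | monomial s u =>
      have h1 := key _ _ _ (key _ _ _ (hmon s u) j) i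
      have h2 := (key _ _ _ (hmon s u) (i + j)).natCast_mul ((i + j).choose i)
      rw [φ.coeff_coeff] at h1
      refine huniq h1 ?_
      convert h2 using 1
      push_cast
      ring
  · intro htop
    have hmem := (ExpMap.mem_invariants_iff_coeff (K := K) _ _).mp
      (htop ▸ Algebra.mem_top : Ideal.Quotient.mk J (X i₀) ∈ _) j₀ hj₀
    have hmem' : (Φ (X i₀)).coeff j₀ = 0 := by
      rw [← hΨ]
      exact hmem
    exact hc₀ (huniq hlead₀ (hmem' ▸ hX i₀ j₀))
  · rw [ExpMap.mem_invariants_iff_coeff] at ha ⊢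
    intro j hj
    have := key n a b hab j
    rw [ha j hj] at this
    exact huniq this (Lead.zero _)

end AssociatedGraded

section Compression

variable {K R : Type} [Field K] [CommRing R] [Algebra K R]

lemma cast_choose_mul_expChar_pow (p b : ℕ) [ExpChar K p] (n l : ℕ) :
    ((n * p ^ b).choose (l * p ^ b) : K) = (n.choose l : K) := by
  have hp : 0 < p ^ b := pow_pos (expChar_pos K p) b
  have h : ((1 + Polynomial.X) ^ (n * p ^ b) : Polynomial K) =
      Polynomial.expand K (p ^ b) ((1 + Polynomial.X) ^ n) := by
    rw [mul_comm, pow_mul, add_pow_expChar_pow, map_pow]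
    simp
  rw [← Polynomial.coeff_one_add_X_pow, h, Polynomial.coeff_expand_mul hp,
    Polynomial.coeff_one_add_X_pow]

lemma exists_eq_expChar_pow_mul (p : ℕ) [ExpChar K p] {n : ℕ} (hn : n ≠ 0) :
    ∃ a u : ℕ, n = u * p ^ a ∧ (u : K) ≠ 0 := by
  rcases ‹ExpChar K p› with _ | hprime
  · exact ⟨0, n, by simp, by exact_mod_cast hn⟩
  · obtain ⟨a, u, hu, rfl⟩ := Nat.exists_eq_pow_mul_and_not_dvd hn p hprime.ne_one
    exact ⟨a, u, mul_comm _ _, fun h => hu ((CharP.cast_eq_zero_iff K p u).mp h)⟩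

/-- If only powers of `U ^ q` occur in a nontrivial exponential map, then `q` is a power of the
characteristic exponent. -/
lemma ExpMap.exists_eq_expChar_pow (p : ℕ) [ExpChar K p] (φ : ExpMap K R)
    (hφ : φ.invariants ≠ ⊤) (q : ℕ) (hq : ∀ a j, (φ.toAlgHom a).coeff j ≠ 0 → q ∣ j) :
    ∃ b, q = p ^ b := by
  classical
  have hex : ∃ j, 1 ≤ j ∧ ∃ a, (φ.toAlgHom a).coeff j ≠ 0 := by
    by_contra! hne
    exact hφ (eq_top_iff.mpr fun a _ => (φ.mem_invariants_iff_coeff a).mpr fun j hj => hne j hj a)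
  obtain ⟨hj, a, ha⟩ := Nat.find_spec hex
  have hmin : ∀ i, 1 ≤ i → i < Nat.find hex → ∀ d, (φ.toAlgHom d).coeff i = 0 := by
    intro i hi hlt d
    by_contra hd
    exact Nat.find_min hex hlt ⟨hi, d, hd⟩
  set n := Nat.find hex
  obtain ⟨c, u, hn, hu⟩ := exists_eq_expChar_pow_mul (K := K) p (Nat.one_le_iff_ne_zero.mp hj)
  have hpc : 0 < p ^ c := pow_pos (expChar_pos K p) c
  have hu1 : u = 1 := by
    by_contra hu1
    have hu2 : 2 ≤ u := by
      have : u ≠ 0 := fun h => hu (by simp [h])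
      omega
    have hlt : p ^ c < n := by nlinarith
    have h := φ.coeff_coeff a (p ^ c) (n - p ^ c)
    rw [hmin _ hpc hlt, Nat.add_sub_cancel' hlt.le] at h
    have hch : (n.choose (p ^ c) : K) = u := by
      have := cast_choose_mul_expChar_pow (K := K) p c u 1
      rwa [one_mul, ← hn, Nat.choose_one_right] at this
    have hunit : IsUnit (n.choose (p ^ c) : R) := by
      have := (IsUnit.mk0 (n.choose (p ^ c) : K) (hch ▸ hu)).map (algebraMap K R)
      rwa [map_natCast] at this
    exact ha ((hunit.mul_right_eq_zero).mp h.symm)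
  have hdvd := hq a n ha
  rw [hn, hu1, one_mul] at hdvd
  rcases expChar_is_prime_or_one K p with hprime | rfl
  · obtain ⟨b, -, hb⟩ := (Nat.dvd_prime_pow hprime).mp hdvd
    exact ⟨b, hb⟩
  · exact ⟨0, by simpa using hdvd⟩

/-- If only powers of `U ^ q` occur in a nontrivial exponential map, then `U ^ q` may be replaced
by `U`. -/
lemma ExpMap.exists_contract (φ : ExpMap K R) (hφ : φ.invariants ≠ ⊤) (q : ℕ)
    (hq : ∀ a j, (φ.toAlgHom a).coeff j ≠ 0 → q ∣ j) :
    ∃ ψ : ExpMap K R, ψ.invariants = φ.invariants ∧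
      ∀ a j, (ψ.toAlgHom a).coeff j = (φ.toAlgHom a).coeff (j * q) := by
  obtain ⟨p, hp⟩ := ExpChar.exists K
  obtain ⟨b, hb⟩ := φ.exists_eq_expChar_pow p hφ q hq
  have hq0 : 0 < q := hb ▸ pow_pos (expChar_pos K p) b
  have hexp : ∀ a, Polynomial.expand R q (Polynomial.contract q (φ.toAlgHom a)) =
      φ.toAlgHom a := by
    intro a
    ext j
    rw [Polynomial.coeff_expand hq0, Polynomial.coeff_contract hq0.ne']
    split_ifs with h
    · rw [Nat.div_mul_cancel h]
    · by_contra h0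
      exact h (hq a j (Ne.symm h0))
  have hinj := Polynomial.expand_injective (R := R) hq0
  let Ψ : R →ₐ[K] Polynomial R := AlgHom.ofLinearMap
    { toFun := fun a => Polynomial.contract q (φ.toAlgHom a)
      map_add' := fun a a' => hinj (by
        rw [map_add (Polynomial.expand R q), hexp, hexp, hexp, map_add])
      map_smul' := fun c a => by
        ext j
        simp [Polynomial.coeff_contract hq0.ne'] }
    (hinj ((hexp 1).trans (by simp))) fun a a' => hinj ((hexp (a * a')).trans (by
      rw [map_mul, map_mul (Polynomial.expand R q)]
      exact (congrArg₂ (· * ·) (hexp a) (hexp a')).symm))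
  have hΨ : ∀ a j, (Ψ a).coeff j = (φ.toAlgHom a).coeff (j * q) :=
    fun a j => Polynomial.coeff_contract hq0.ne' _ j
  let ψ : ExpMap K R :=
    { toAlgHom := Ψ
      eval_zero := fun d => by
        rw [← Polynomial.coeff_zero_eq_eval_zero, hΨ, zero_mul, φ.coeff_zero]
      comp_add := fun d => (comp_add_iff_coeff Ψ d).mpr fun i j => by
        rw [hΨ, hΨ, hΨ, φ.coeff_coeff, ← add_mul]
        congr 1
        have := congrArg (algebraMap K R) (cast_choose_mul_expChar_pow (K := K) p b (i + j) i)
        rwa [← hb, map_natCast, map_natCast] at this }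
  refine ⟨ψ, ?_, hΨ⟩
  ext a
  rw [ψ.mem_invariants_iff_coeff, φ.mem_invariants_iff_coeff]
  constructor
  · intro h j hj
    by_contra h0
    obtain ⟨l, rfl⟩ := hq a j h0
    refine h0 ?_
    rw [mul_comm, ← hΨ]
    exact h l (Nat.pos_of_mul_pos_left hj)
  · intro h j hj
    exact (hΨ a j).trans (h _ (Nat.mul_pos hj hq0))

end Compression

section NormalForm

variable {K σ : Type} [Field K]

/-- No monomial of `p` is divisible by the monomial with exponent `s₀`. -/
def NormalForm (s₀ : σ →₀ ℕ) (p : MvPolynomial σ K) : Prop :=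
  ∀ s, coeff s p ≠ 0 → ¬ s₀ ≤ s

namespace NormalForm

variable {s₀ : σ →₀ ℕ} {y : σ}

lemma add {p q : MvPolynomial σ K} (hp : NormalForm s₀ p) (hq : NormalForm s₀ q) :
    NormalForm s₀ (p + q) := by
  intro s hs
  by_cases h : coeff s p = 0
  · exact hq s fun h' => hs (by simp [h, h'])
  · exact hp s h

lemma component {W : σ → ℚ} {n : ℚ} {p : MvPolynomial σ K} (hp : NormalForm s₀ p) :
    NormalForm s₀ (weightedHomogeneousComponent W n p) := by
  classical
  intro s hs
  rw [coeff_weightedHomogeneousComponent] at hs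
  split_ifs at hs
  · exact hp s hs
  · exact absurd rfl hs

lemma modMonomial (p : MvPolynomial σ K) : NormalForm s₀ (p.modMonomial s₀) :=
  fun _ hs h => hs (coeff_modMonomial_of_le p h)

/-- Modulo a relation rewriting a monomial involving `y` into a `y`-free polynomial, every
polynomial has a normal form. -/
lemma exists_mk_eq (hy : s₀ y ≠ 0) {H : MvPolynomial σ K} (hH : ∀ s, coeff s H ≠ 0 → s y = 0)
    (a : MvPolynomial σ K ⧸ Ideal.span {monomial s₀ 1 - H}) :
    ∃ q, NormalForm s₀ q ∧ Ideal.Quotient.mk _ q = a := by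
  classical
  have key : ∀ (N : ℕ) (p : MvPolynomial σ K), (∀ s, coeff s p ≠ 0 → s y < N) →
      ∃ q, NormalForm s₀ q ∧ Ideal.Quotient.mk (Ideal.span {monomial s₀ 1 - H}) q =
        Ideal.Quotient.mk _ p := by
    intro N
    induction N with
    | zero =>
      intro p hp
      exact ⟨p, fun s hs => absurd (hp s hs) (Nat.not_lt_zero _), rfl⟩
    | succ N ih =>
      intro p hp
      obtain ⟨q, hq, hqp⟩ := ih (H * (p.divMonomial s₀)) fun s hs => by
        rw [coeff_mul] at hs
        obtain ⟨⟨u, v⟩, huv, h⟩ := Finset.exists_ne_zero_of_sum_ne_zero hs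
        rw [Finset.HasAntidiagonal.mem_antidiagonal] at huv
        simp only at huv h
        have hu := hH u (left_ne_zero_of_mul h)
        have hv := right_ne_zero_of_mul h
        rw [coeff_divMonomial] at hv
        have := hp _ hv
        rw [← huv]
        simp only [Finsupp.add_apply] at this ⊢
        omega
      refine ⟨q + p.modMonomial s₀, hq.add (modMonomial p), ?_⟩
      rw [map_add, hqp, ← map_add, Ideal.Quotient.eq]
      refine Ideal.mem_span_singleton'.mpr ⟨-(p.divMonomial s₀), ?_⟩
      conv_rhs =>
        arg 2
        rw [← divMonomial_add_modMonomial p s₀]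
      ring
  obtain ⟨p, rfl⟩ := Ideal.Quotient.mk_surjective a
  exact key (p.support.sup (fun s => s y) + 1) p fun s hs => Nat.lt_succ_of_le
    (Finset.le_sup (f := fun s : σ →₀ ℕ => s y) (mem_support_iff.mpr hs))

lemma mk_ne_zero (hy : s₀ y = 1) {H : MvPolynomial σ K} (hH : ∀ s, coeff s H ≠ 0 → s y = 0)
    {p : MvPolynomial σ K} (hp : NormalForm s₀ p) (hp0 : p ≠ 0) :
    Ideal.Quotient.mk (Ideal.span {monomial s₀ 1 - H}) p ≠ 0 := by
  classical
  intro h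
  rw [Ideal.Quotient.eq_zero_iff_mem] at h
  set W : σ → ℚ := Pi.single y 1
  have hW : ∀ s : σ →₀ ℕ, Finsupp.weight W s = s y := fun s => by
    rw [Finsupp.weight_apply, Finsupp.sum]
    simp only [W, Pi.single_apply, nsmul_eq_mul, mul_ite, mul_one, mul_zero]
    rw [Finset.sum_ite_eq', ite_eq_left_iff]
    intro h
    rw [Finsupp.notMem_support_iff.mp h, Nat.cast_zero]
  have hs₀ : (monomial s₀ (1 : K)).IsWeightedHomogeneous W 1 :=
    isWeightedHomogeneous_monomial W s₀ 1 (by rw [hW, hy, Nat.cast_one])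
  have hH0 : DegLE W 0 H := fun s hs => by rw [hW, hH s hs, Nat.cast_zero]
  have htop : weightedHomogeneousComponent W 1 (monomial s₀ 1 - H) = monomial s₀ 1 := by
    rw [map_sub, hH0.component_eq_zero one_pos, sub_zero, weightedHomogeneousComponent_eq_self hs₀]
  have hG : DegLE W 1 (monomial s₀ 1 - H) :=
    sub_eq_add_neg (monomial s₀ (1 : K)) H ▸ hs₀.degLE.add (hH0.mono zero_le_one).neg
  obtain ⟨n, hn, hn0⟩ := exists_degLE_component_ne_zero W hp0
  have hmem := component_mem_span hG (by simp [htop]) hn h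
  rw [htop, Ideal.mem_span_singleton, monomial_one_dvd_iff_modMonomial_eq_zero] at hmem
  obtain ⟨s, hs⟩ := ne_zero_iff.mp hn0
  refine hs ?_
  rw [← coeff_modMonomial_of_not_le _ (hp.component s hs), hmem, coeff_zero]

end NormalForm

lemma exists_lead_ne_zero {s₀ : σ →₀ ℕ} {y : σ} (hy : s₀ y = 1) {H H' : MvPolynomial σ K}
    (hH : ∀ s, coeff s H ≠ 0 → s y = 0) (hH' : ∀ s, coeff s H' ≠ 0 → s y = 0) (W : σ → ℚ)
    (a : MvPolynomial σ K ⧸ Ideal.span {monomial s₀ 1 - H}) (ha : a ≠ 0) :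
    ∃ δ b, Lead W _ (Ideal.span {monomial s₀ 1 - H'}) δ a b ∧ b ≠ 0 := by
  obtain ⟨p, hp, rfl⟩ := NormalForm.exists_mk_eq (by omega) hH a
  obtain ⟨n, hn, hn0⟩ := exists_degLE_component_ne_zero W (p := p) (by rintro rfl; simp at ha)
  exact ⟨n, _, ⟨p, hn, rfl, rfl⟩, NormalForm.mk_ne_zero hy hH' hp.component hn0⟩

end NormalForm

section Homogeneity

variable {K σ : Type} [Field K]

lemma weight_intCast (w : σ → ℤ) (s : σ →₀ ℕ) :
    Finsupp.weight (fun i => (w i : ℚ)) s = (Finsupp.weight w s : ℤ) := by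
  simp [Finsupp.weight_apply, Finsupp.sum]

lemma isWeightedHomogeneous_intCast {w : σ → ℤ} {d : ℤ} {p : MvPolynomial σ K} :
    p.IsWeightedHomogeneous (fun i => (w i : ℚ)) (d : ℚ) ↔ p.IsWeightedHomogeneous w d := by
  refine forall_congr' fun s => forall_congr' fun _ => ?_
  rw [weight_intCast, Int.cast_inj]

lemma Rat.den_dvd_of_natCast_mul_eq {E : ℚ} {j : ℕ} {z : ℤ} (h : j * E = z) : E.den ∣ j := by
  have h1 : (j : ℤ) * E.num = z * E.den := by
    have : (j : ℚ) * E.num = z * E.den := by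
      rw [← h, mul_assoc, Rat.mul_den_eq_num]
    exact_mod_cast this
  have h2 : (E.den : ℤ) ∣ j * E.num := ⟨z, by rw [h1, mul_comm]⟩
  have h3 : IsCoprime (E.den : ℤ) E.num := by
    rw [Int.isCoprime_iff_gcd_eq_one, Int.gcd_comm]
    exact E.reduced
  exact Int.natCast_dvd_natCast.mp (h3.dvd_of_dvd_mul_right h2)

/-- An exponential map which is homogeneous with respect to a rational weight of the parameter can
be replaced by one which is homogeneous with respect to an integral weight. -/
lemma ExpMap.exists_integral_homogeneous {w : σ → ℤ} {J : Ideal (MvPolynomial σ K)}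
    (ψ : ExpMap K (MvPolynomial σ K ⧸ J)) (hψ : ψ.invariants ≠ ⊤) (E : ℚ)
    (h : ∀ (p : MvPolynomial σ K) (n : ℚ), p.IsWeightedHomogeneous (fun i => (w i : ℚ)) n →
      ∀ j : ℕ, ∃ q : MvPolynomial σ K, q.IsWeightedHomogeneous (fun i => (w i : ℚ)) (n + j * E) ∧
        Ideal.Quotient.mk J q = (ψ.toAlgHom (Ideal.Quotient.mk J p)).coeff j) :
    ∃ φ : ExpMap K (MvPolynomial σ K ⧸ J), φ.invariants = ψ.invariants ∧
      ∃ e : ℤ, ∀ (p : MvPolynomial σ K) (d : ℤ), p.IsWeightedHomogeneous w d → ∀ j : ℕ,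
        ∃ q : MvPolynomial σ K, q.IsWeightedHomogeneous w (d - j * e) ∧
          Ideal.Quotient.mk J q = (φ.toAlgHom (Ideal.Quotient.mk J p)).coeff j := by
  obtain ⟨φ, hφ, hcoeff⟩ := ψ.exists_contract hψ E.den fun a j ha => by
    obtain ⟨p, rfl⟩ := Ideal.Quotient.mk_surjective a
    by_contra hdvd
    refine ha ?_
    clear ha
    induction p using MvPolynomial.induction_on' with
    | add p q hp hq =>
      rw [map_add, map_add, Polynomial.coeff_add, hp, hq, add_zero]
    | monomial s c =>
      obtain ⟨q, hq, hqc⟩ := h _ _ (isWeightedHomogeneous_monomial _ s c rfl) j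
      rw [← hqc]
      suffices q = 0 by rw [this, map_zero]
      by_contra hq0
      obtain ⟨t, ht⟩ := ne_zero_iff.mp hq0
      have := hq ht
      rw [weight_intCast, weight_intCast] at this
      refine hdvd (Rat.den_dvd_of_natCast_mul_eq
        (z := Finsupp.weight w t - Finsupp.weight w s) ?_)
      push_cast
      linarith
  refine ⟨φ, hφ, -E.num, fun p d hp j => ?_⟩
  obtain ⟨q, hq, hqc⟩ := h p d (isWeightedHomogeneous_intCast.mpr hp) (j * E.den)
  refine ⟨q, isWeightedHomogeneous_intCast.mp ?_, by rw [hcoeff, hqc]⟩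
  convert hq using 1
  push_cast
  rw [mul_assoc, mul_comm (E.den : ℚ), Rat.mul_den_eq_num]
  ring

end Homogeneity

section Hypersurface

variable {K : Type} [Field K] {m : ℕ}

/-- The exponent of the monomial `X_1^{r_1}⋯X_m^{r_m}·Y`. -/
def topExponent (r : Fin m → ℕ) : Fin m ⊕ Fin 3 →₀ ℕ :=
  Finsupp.equivFunOnFinite.symm (Sum.elim r (Pi.single 0 1))

lemma monomial_topExponent (r : Fin m → ℕ) :
    (monomial (topExponent r) 1 : BigP K m) = (∏ i, X (Sum.inl i) ^ r i) * X (Sum.inr 0) := by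
  rw [monomial_eq, C_1, one_mul, Finsupp.prod_fintype _ _ fun _ => pow_zero _,
    Fintype.prod_sum_type, Fin.prod_univ_three]
  simp [topExponent]

lemma relG_eq (r : Fin m → ℕ) (F : MvPolynomial (Fin m ⊕ Fin 2) K) :
    relG K m r F = monomial (topExponent r) 1 - incl K m F := by
  rw [monomial_topExponent, relG]

lemma relHat_eq (r : Fin m → ℕ) (F : MvPolynomial (Fin m ⊕ Fin 2) K) :
    relHat K m r F = relG K m r (rename Sum.inr (fOf K m F)) := by
  rw [relHat, relG, incl, rename_rename]
  rfl

lemma coeff_incl_ne_zero (F : MvPolynomial (Fin m ⊕ Fin 2) K) (s : Fin m ⊕ Fin 3 →₀ ℕ)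
    (h : coeff s (incl K m F) ≠ 0) : s (Sum.inr 0) = 0 := by
  obtain ⟨u, rfl, -⟩ := coeff_rename_ne_zero _ _ _ h
  refine Finsupp.mapDomain_of_notMem_range _ _ ?_
  rintro ⟨i | j, h⟩
  · cases h
  · exact Fin.succ_ne_zero j (Sum.inr_injective h)

/-- The polynomial obtained from `F` by setting to zero the variables `X_i` with `i ∈ S`. -/
def killX (S : Finset (Fin m)) (F : MvPolynomial (Fin m ⊕ Fin 2) K) :
    MvPolynomial (Fin m ⊕ Fin 2) K :=
  aeval (Sum.elim (fun i => if i ∈ S then 0 else X (Sum.inl i)) fun j => X (Sum.inr j)) F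

lemma fOf_killX (S : Finset (Fin m)) (F : MvPolynomial (Fin m ⊕ Fin 2) K) :
    fOf K m (killX S F) = fOf K m F := by
  rw [fOf, fOf, killX, ← AlgHom.comp_apply]
  congr 1
  ext (i | j)
  · simp only [AlgHom.comp_apply, aeval_X, Sum.elim_inl]
    split_ifs <;> simp
  · simp

lemma killX_univ (F : MvPolynomial (Fin m ⊕ Fin 2) K) :
    killX Finset.univ F = rename Sum.inr (fOf K m F) := by
  rw [fOf, killX, ← AlgHom.comp_apply]
  congr 1
  ext (i | j) <;> simp

/-- The weights for which the variables `X_i` with `i ∈ S` have weight `-1` and the relation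
defining `A` has a top form of degree zero. -/
def partialWeight (r : Fin m → ℕ) (S : Finset (Fin m)) : Fin m ⊕ Fin 3 → ℚ :=
  Sum.elim (fun i => if i ∈ S then -1 else 0) (Pi.single 0 (∑ i ∈ S, (r i : ℚ)))

lemma weight_partialWeight (r : Fin m → ℕ) (S : Finset (Fin m)) (s : Fin m ⊕ Fin 3 →₀ ℕ) :
    Finsupp.weight (partialWeight r S) s =
      s (Sum.inr 0) * ∑ i ∈ S, (r i : ℚ) - ∑ i ∈ S, (s (Sum.inl i) : ℚ) := by
  rw [Finsupp.weight_apply, Finsupp.sum_fintype _ _ (by simp),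
    Fintype.sum_sum_type, Fin.sum_univ_three]
  simp [partialWeight, Finset.sum_ite_mem, sub_eq_neg_add]

lemma partialWeight_univ (r : Fin m → ℕ) :
    partialWeight r Finset.univ = fun i => (wtHat m r i : ℚ) := by
  ext (i | j)
  · simp [partialWeight, wtHat]
  · simp only [partialWeight, wtHat, Sum.elim_inr, Pi.single_apply]
    split_ifs <;> simp

lemma isWeightedHomogeneous_topExponent (r : Fin m → ℕ) (S : Finset (Fin m)) :
    (monomial (topExponent r) (1 : K)).IsWeightedHomogeneous (partialWeight r S) 0 :=
  isWeightedHomogeneous_monomial _ _ _ (by simp [weight_partialWeight, topExponent])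

lemma component_incl (r : Fin m → ℕ) (S : Finset (Fin m))
    (F : MvPolynomial (Fin m ⊕ Fin 2) K) :
    DegLE (partialWeight r S) 0 (incl K m F) ∧
      weightedHomogeneousComponent (partialWeight r S) 0 (incl K m F) =
        incl K m (killX S F) := by
  set W := partialWeight r S
  have hC : ∀ c : K, (C c : BigP K m).IsWeightedHomogeneous W 0 := isWeightedHomogeneous_C W
  have hX : ∀ v, DegLE W 0 (incl K m (X v)) ∧
      weightedHomogeneousComponent W 0 (incl K m (X v)) = incl K m (killX S (X v)) := by
    have hhom : ∀ v, (X v : BigP K m).IsWeightedHomogeneous W (W v) := isWeightedHomogeneous_X K W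
    rintro (i | j)
    · by_cases hi : i ∈ S
      · have h := hhom (Sum.inl i)
        have hW : W (Sum.inl i) = -1 := by simp [W, partialWeight, hi]
        rw [hW] at h
        refine ⟨?_, ?_⟩
        · simpa [incl] using h.degLE.mono (by norm_num)
        · simpa [incl, killX, hi] using h.degLE.component_eq_zero (by norm_num)
      · have h := hhom (Sum.inl i)
        have hW : W (Sum.inl i) = 0 := by simp [W, partialWeight, hi]
        rw [hW] at h
        refine ⟨by simpa [incl] using h.degLE, ?_⟩
        simpa [incl, killX, hi] using weightedHomogeneousComponent_eq_self h
    · have h := hhom (Sum.inr j.succ)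
      have hW : W (Sum.inr j.succ) = 0 := by simp [W, partialWeight]
      rw [hW] at h
      refine ⟨by simpa [incl] using h.degLE, ?_⟩
      simpa [incl, killX] using weightedHomogeneousComponent_eq_self h
  induction F using MvPolynomial.induction_on with
  | C c =>
    have h1 : incl K m (C c) = C c := rename_C _ _
    have h2 : killX S (C c) = C c := aeval_C _ _
    rw [h2, h1]
    exact ⟨(hC c).degLE, weightedHomogeneousComponent_eq_self (hC c)⟩
  | add p q hp hq =>
    have h2 : killX S (p + q) = killX S p + killX S q := map_add _ _ _
    rw [h2, map_add, map_add, map_add, hp.2, hq.2]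
    exact ⟨hp.1.add hq.1, rfl⟩
  | mul_X p v hp =>
    have h2 : killX S (p * X v) = killX S p * killX S (X v) := map_mul _ _ _
    rw [h2, map_mul (incl K m), map_mul (incl K m), ← hp.2, ← (hX v).2]
    have h3 := hp.1.component_mul (hX v).1
    have h4 := hp.1.mul (hX v).1
    rw [add_zero] at h3 h4
    exact ⟨h4, h3⟩

lemma degLE_relG (r : Fin m → ℕ) (S : Finset (Fin m)) (F : MvPolynomial (Fin m ⊕ Fin 2) K) :
    DegLE (partialWeight r S) 0 (relG K m r F) := by
  rw [relG_eq, sub_eq_add_neg]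
  exact (isWeightedHomogeneous_topExponent r S).degLE.add (component_incl r S F).1.neg

lemma component_relG (r : Fin m → ℕ) (S : Finset (Fin m)) (F : MvPolynomial (Fin m ⊕ Fin 2) K) :
    weightedHomogeneousComponent (partialWeight r S) 0 (relG K m r F) =
      relG K m r (killX S F) := by
  rw [relG_eq, relG_eq, map_sub, (component_incl r S F).2,
    weightedHomogeneousComponent_eq_self (isWeightedHomogeneous_topExponent r S)]

lemma relG_ne_zero (r : Fin m → ℕ) (F : MvPolynomial (Fin m ⊕ Fin 2) K) :
    relG K m r F ≠ 0 := by
  intro h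
  have h1 := congrArg (coeff (topExponent r)) h
  have h2 : coeff (topExponent r) (incl K m F) = 0 := by
    by_contra h0
    simpa [topExponent] using coeff_incl_ne_zero F _ h0
  rw [relG_eq, coeff_sub, h2, coeff_monomial, if_pos rfl, coeff_zero, sub_zero] at h1
  exact one_ne_zero h1

/-- An exponential map on `A` induces one on the hypersurface obtained by setting the variables
`X_i`, `i ∈ S`, to zero in `F`. -/
lemma exists_expMap_killX (r : Fin m → ℕ) (S : Finset (Fin m))
    (F : MvPolynomial (Fin m ⊕ Fin 2) K) {J : Ideal (BigP K m)}
    (hJ : J = Ideal.span {relG K m r (killX S F)}) (φ : ExpMap K (RingA K m r F))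
    (hφ : φ.invariants ≠ ⊤) :
    ∃ (E : ℚ) (ψ : ExpMap K (BigP K m ⧸ J)), ψ.invariants ≠ ⊤ ∧
      (∀ n a b, Lead (partialWeight r S) _ J n a b → a ∈ φ.invariants → b ∈ ψ.invariants) ∧
      ∀ n a b, Lead (partialWeight r S) _ J n a b → ∀ j : ℕ,
        Lead (partialWeight r S) _ J (n + j * E) ((φ.toAlgHom a).coeff j)
          ((ψ.toAlgHom b).coeff j) := by
  refine exists_graded_expMap rfl (hJ.trans (by rw [component_relG])) (degLE_relG r S F) ?_ ?_ φ hφ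
  · rw [component_relG]
    exact relG_ne_zero r _
  · subst hJ
    have key := exists_lead_ne_zero (y := Sum.inr 0) (s₀ := topExponent r) (by simp [topExponent])
      (coeff_incl_ne_zero F) (coeff_incl_ne_zero (killX S F)) (partialWeight r S)
    rw [← relG_eq, ← relG_eq] at key
    exact key

lemma isDomain_ringA (r : Fin m → ℕ) (F : MvPolynomial (Fin m ⊕ Fin 2) K) (hf : fOf K m F ≠ 0) :
    IsDomain (RingA K m r F) := by
  have hvars : ∀ p : BigP K m, (∀ s, coeff s p ≠ 0 → s (Sum.inr 0) = 0) →
      Sum.inr 0 ∉ p.vars := by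
    intro p hp h
    obtain ⟨s, hs, hsv⟩ := (mem_vars_iff_mem_support _).mp h
    exact Finsupp.mem_support_iff.mp hsv (hp s (mem_support_iff.mp hs))
  have hprod : (∏ i, X (Sum.inl i) ^ r i : BigP K m) =
      monomial (Finsupp.equivFunOnFinite.symm (Sum.elim r 0)) 1 := by
    rw [monomial_eq, C_1, one_mul, Finsupp.prod_fintype _ _ fun _ => pow_zero _,
      Fintype.prod_sum_type, Fin.prod_univ_three]
    simp
  have hirr : Irreducible (relG K m r F) := by
    rw [relG, sub_eq_add_neg]
    refine irreducible_mul_X_add _ _ _ ?_ (hvars _ fun s hs => ?_) (hvars _ fun s hs => ?_) ?_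
    · exact Finset.prod_ne_zero_iff.mpr fun i _ => pow_ne_zero _ (X_ne_zero _)
    · rw [hprod, coeff_monomial] at hs
      split_ifs at hs with h
      · simp [← h]
      · exact absurd rfl hs
    · exact coeff_incl_ne_zero F s (by simpa using hs)
    · refine IsRelPrime.prod_left fun i _ => IsRelPrime.pow_left ?_
      rw [(X_prime (R := K)).irreducible.isRelPrime_iff_not_dvd, dvd_neg]
      rintro ⟨u, hu⟩
      have h := congrArg (aeval (Sum.elim (fun _ => 0) ![0, X 0, X 1]) :
        BigP K m →ₐ[K] MvPolynomial (Fin 2) K) hu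
      rw [map_mul, aeval_X, Sum.elim_inl, zero_mul, incl, aeval_rename] at h
      refine hf ?_
      refine Eq.trans ?_ h
      rw [fOf]
      congr 2
      ext (i | j) : 1
      · rfl
      · fin_cases j <;> rfl
  have hprime : (Ideal.span {relG K m r F}).IsPrime :=
    (Ideal.span_singleton_prime hirr.ne_zero).mpr hirr.prime
  exact Ideal.Quotient.isDomain _

end Hypersurface

section Invariants

variable {K : Type} [Field K] {m : ℕ} {r : Fin m → ℕ} {F : MvPolynomial (Fin m ⊕ Fin 2) K}

lemma exists_invariant_notMem_BA (hlt : BA K m r F < Derksen K (RingA K m r F)) :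
    ∃ φ : ExpMap K (RingA K m r F), φ.invariants ≠ ⊤ ∧ ∃ g ∈ φ.invariants, g ∉ BA K m r F := by
  by_contra! h
  refine hlt.not_ge (Algebra.adjoin_le fun g hg => ?_)
  simp only [Set.mem_iUnion] at hg
  obtain ⟨φ, hφ, hg⟩ := hg
  exact h φ hφ g hg

lemma mk_mem_BA {p : BigP K m} (hp : ∀ s, coeff s p ≠ 0 → s (Sum.inr 0) = 0) :
    Ideal.Quotient.mk (Ideal.span {relG K m r F}) p ∈ BA K m r F := by
  have hsub : Set.range (xA K m r F) ∪ {zA K m r F, tA K m r F} ⊆ BA K m r F :=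
    Algebra.subset_adjoin
  rw [p.as_sum, map_sum]
  refine sum_mem fun s hs => ?_
  rw [monomial_eq, map_mul, Finsupp.prod_fintype _ _ fun _ => pow_zero _, map_prod]
  refine mul_mem ((BA K m r F).algebraMap_mem (coeff s p)) (prod_mem fun v _ => ?_)
  rw [map_pow]
  rcases v with i | j
  · exact pow_mem (hsub (Or.inl ⟨i, rfl⟩)) _
  · fin_cases j
    · simp [hp s (mem_support_iff.mp hs)]
    · exact pow_mem (hsub (Or.inr (Or.inl rfl))) _
    · exact pow_mem (hsub (Or.inr (Or.inr rfl))) _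

lemma exists_eq_X_mul {σ : Type} {v : σ} {p : MvPolynomial σ K}
    (hp : ∀ s, coeff s p ≠ 0 → s v ≠ 0) : ∃ u, p = X v * u := by
  refine X_dvd_iff_modMonomial_eq_zero.mpr ?_
  ext s
  by_cases hs : Finsupp.single v 1 ≤ s
  · rw [coeff_modMonomial_of_le _ hs, coeff_zero]
  · rw [coeff_modMonomial_of_not_le _ hs, coeff_zero]
    by_contra h
    exact hs (Finsupp.single_le_iff.mpr (Nat.one_le_iff_ne_zero.mpr (hp s h)))

/-- If `B` is strictly contained in the Derksen invariant of `A`, then `y` is invariant under a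
nontrivial exponential map, after setting some `X_i` to zero in `F`. -/
lemma exists_expMap_yA_mem (hf : fOf K m F ≠ 0)
    (hlt : BA K m r F < Derksen K (RingA K m r F)) :
    ∃ (i : Fin m) (ψ : ExpMap K (RingA K m r (killX {i} F))),
      ψ.invariants ≠ ⊤ ∧ yA K m r (killX {i} F) ∈ ψ.invariants := by
  obtain ⟨φ, hφ, g, hgφ, hgB⟩ := exists_invariant_notMem_BA hlt
  obtain ⟨p, hp, hpg⟩ : ∃ p, NormalForm (topExponent r) p ∧
      Ideal.Quotient.mk (Ideal.span {relG K m r F}) p = g := by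
    have h := NormalForm.exists_mk_eq (y := Sum.inr 0) (s₀ := topExponent r)
      (by simp [topExponent]) (coeff_incl_ne_zero F)
    rw [← relG_eq] at h
    exact h g
  subst hpg
  obtain ⟨s, hs, hsy⟩ : ∃ s, coeff s p ≠ 0 ∧ s (Sum.inr 0) ≠ 0 := by
    by_contra! h
    exact hgB (mk_mem_BA h)
  obtain ⟨i, hi⟩ : ∃ i, s (Sum.inl i) < r i := by
    by_contra! h
    refine hp s hs fun v => ?_
    rcases v with i | j
    · simpa [topExponent] using h i
    · fin_cases j <;> simp [topExponent, Nat.one_le_iff_ne_zero, hsy]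
  obtain ⟨n, hn, hn0⟩ := exists_degLE_component_ne_zero (partialWeight r {i})
    (ne_zero_iff.mpr ⟨s, hs⟩)
  have hnpos : 0 < n := by
    refine lt_of_lt_of_le ?_ (hn s hs)
    rw [weight_partialWeight, Finset.sum_singleton, Finset.sum_singleton, sub_pos]
    have h1 : r i ≤ s (Sum.inr 0) * r i := Nat.le_mul_of_pos_left _ (Nat.pos_of_ne_zero hsy)
    exact_mod_cast hi.trans_le h1
  have := isDomain_ringA r (killX {i} F) (by rwa [fOf_killX])
  obtain ⟨E, ψ, hψ, hinv, -⟩ := exists_expMap_killX r {i} F rfl φ hφ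
  refine ⟨i, ψ, hψ, ?_⟩
  obtain ⟨u, hu⟩ := exists_eq_X_mul (v := Sum.inr 0)
    (p := weightedHomogeneousComponent (partialWeight r {i}) n p) fun t ht h0 => by
      have hw := weightedHomogeneousComponent_isWeightedHomogeneous n p ht
      rw [weight_partialWeight, h0, Finset.sum_singleton, Finset.sum_singleton] at hw
      have : (0 : ℚ) ≤ t (Sum.inl i) := Nat.cast_nonneg _
      push_cast at hw
      linarith
  have hne := NormalForm.mk_ne_zero (y := Sum.inr 0) (by simp [topExponent])
    (coeff_incl_ne_zero (killX {i} F)) hp.component hn0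
  rw [← relG_eq, hu, map_mul] at hne
  refine ψ.mem_invariants_of_mul (a := yA K m r (killX {i} F)) hne ?_
  refine hinv n _ _ ⟨p, hn, rfl, ?_⟩ hgφ
  rw [hu, map_mul]
  rfl

end Invariants

theorem statement10 (k : Type) [Field k] (m : ℕ) (hm : 1 ≤ m)
    (r : Fin m → ℕ) (hr : ∀ i, 1 < r i)
    (F : MvPolynomial (Fin m ⊕ Fin 2) k) (hf : fOf k m F ≠ 0)
    [IsDomain (RingA k m r F)]
    (hlt : BA k m r F < Derksen k (RingA k m r F)) :
    ∃ φ : ExpMap k (AHat k m r F),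
      φ.invariants ≠ ⊤ ∧
      (∃ e : ℤ, ∀ (a : AHat k m r F) (d : ℤ), IsHomElem k m r F a d →
        ∀ j : ℕ, IsHomElem k m r F ((φ.toAlgHom a).coeff j) (d - (j : ℤ) * e)) ∧
      yHat k m r F ∈ φ.invariants := by
  obtain ⟨i, ψ, hψ, hy⟩ := exists_expMap_yA_mem hf hlt
  have hJ : Ideal.span {relHat k m r F} =
      Ideal.span {relG k m r (killX Finset.univ (killX {i} F))} := by
    rw [killX_univ, fOf_killX, relHat_eq]
  obtain ⟨E, χ, hχ, hinv, hlead⟩ := exists_expMap_killX r Finset.univ (killX {i} F) hJ ψ hψ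
  rw [partialWeight_univ] at hinv hlead
  obtain ⟨φ, hφ, e, he⟩ := χ.exists_integral_homogeneous (w := wtHat m r) hχ E
    fun p n hp j => (hlead n _ _ (Lead.of_homogeneous hp) j).exists_homogeneous
  refine ⟨φ, hφ ▸ hχ, ⟨e, ?_⟩, ?_⟩
  · rintro a d ⟨p, hp, rfl⟩ j
    exact he p d hp j
  · rw [hφ]
    exact hinv _ _ _ (Lead.of_homogeneous (isWeightedHomogeneous_X k _ (Sum.inr 0))) hy
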